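/- For all U, V ∈ S₂(H), d(exp U, exp V) ≥ ‖U − V‖₂; explicitly, ‖log(exp(−U/2) · exp(V) · exp(−U/2))‖₂ ≥ ‖U − V‖₂. (This is the Al-Kashi inequality c² ≥ a² + b² − 2ab·cos θ for the geodesic triangle of P with vertices the identity, exp U and exp V, whose angle at the identity equals the Euclidean angle between U and V.) -/

import Mathlib

noncomputable section

open scoped InnerProductSpace

variable {H : Type*} [NormedAddCommGroup H] [InnerProductSpace ℂ H] [CompleteSpace H]
variable {ι : Type*}

/-- `A` is a Hilbert–Schmidt operator (w.r.t. the Hilbert basis `e`). -/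
def IsHS (e : HilbertBasis ι ℂ H) (A : H →L[ℂ] H) : Prop :=
  Summable fun i => ‖A (e i)‖ ^ 2

/-- The Hilbert–Schmidt norm of `A` (w.r.t. the Hilbert basis `e`). -/
def hsNorm (e : HilbertBasis ι ℂ H) (A : H →L[ℂ] H) : ℝ :=
  Real.sqrt (∑' i, ‖A (e i)‖ ^ 2)

/-- The real Hilbert–Schmidt inner product `⟨A, B⟩₂ = ∑ ⟪A eᵢ, B eᵢ⟫`. -/
def hsInner (e : HilbertBasis ι ℂ H) (A B : H →L[ℂ] H) : ℝ :=
  (∑' i, (inner ℂ (A (e i)) (B (e i)) : ℂ)).re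

/-- The trace of an operator, `Tr T = ∑ ⟪eᵢ, T eᵢ⟫`. -/
def opTrace (e : HilbertBasis ι ℂ H) (T : H →L[ℂ] H) : ℂ :=
  ∑' i, (inner ℂ (e i) (T (e i)) : ℂ)

/-- `T` is trace class: it is the product of two Hilbert–Schmidt operators. -/
def IsTraceClass (e : HilbertBasis ι ℂ H) (T : H →L[ℂ] H) : Prop :=
  ∃ B C : H →L[ℂ] H, IsHS e B ∧ IsHS e C ∧ T = B * C

/-- `A ∈ S₂(H)`: self-adjoint and Hilbert–Schmidt. -/
def MemS2 (e : HilbertBasis ι ℂ H) (A : H →L[ℂ] H) : Prop :=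
  IsSelfAdjoint A ∧ IsHS e A

/-- `p ∈ P`: self-adjoint, positive definite (invertible and `⟪p x, x⟫ ≥ 0`),
with `p - 1` Hilbert–Schmidt. -/
def MemP (e : HilbertBasis ι ℂ H) (p : H →L[ℂ] H) : Prop :=
  IsSelfAdjoint p ∧ IsUnit p ∧ (∀ x : H, 0 ≤ (inner ℂ (p x) x : ℂ).re) ∧ IsHS e (p - 1)

/-- `x ∈ GL₂(H)`: invertible with `x - 1` Hilbert–Schmidt. -/
def MemGL2 (e : HilbertBasis ι ℂ H) (x : H →L[ℂ] H) : Prop :=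
  IsUnit x ∧ IsHS e (x - 1)

/-- `x ∈ U₂(H)`: unitary with `x - 1` Hilbert–Schmidt. -/
def MemU2 (e : HilbertBasis ι ℂ H) (x : H →L[ℂ] H) : Prop :=
  x ∈ unitary (H →L[ℂ] H) ∧ IsHS e (x - 1)

/-- `p^{1/2}`, via continuous functional calculus. -/
def psqrt (p : H →L[ℂ] H) : H →L[ℂ] H := cfc Real.sqrt p

/-- `p^{-1/2}`, via continuous functional calculus. -/
def pinvsqrt (p : H →L[ℂ] H) : H →L[ℂ] H := cfc (fun t : ℝ => (Real.sqrt t)⁻¹) p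

/-- `log p`, via continuous functional calculus. -/
def plog (p : H →L[ℂ] H) : H →L[ℂ] H := cfc Real.log p

/-- The geodesic distance `d(p, q) = ‖log (p^{-1/2} q p^{-1/2})‖₂`. -/
def gdist (e : HilbertBasis ι ℂ H) (p q : H →L[ℂ] H) : ℝ :=
  hsNorm e (plog (pinvsqrt p * q * pinvsqrt p))

/-- The commutator `[A, B] = AB - BA`. -/
def brk (A B : H →L[ℂ] H) : H →L[ℂ] H := A * B - B * A

/-- The constant-speed geodesic `t ↦ p^{1/2} exp(t K) p^{1/2}`. -/
def geoCurve (p K : H →L[ℂ] H) (t : ℝ) : H →L[ℂ] H :=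
  psqrt p * NormedSpace.exp (t • K) * psqrt p

/-- The geodesic from `p` to `q`:
`t ↦ p^{1/2} exp(t log(p^{-1/2} q p^{-1/2})) p^{1/2}`. -/
def geodesic (p q : H →L[ℂ] H) (t : ℝ) : H →L[ℂ] H :=
  geoCurve p (plog (pinvsqrt p * q * pinvsqrt p)) t

/-- The image `exp E` of a set of operators under the exponential map. -/
def expSet (E : Set (H →L[ℂ] H)) : Set (H →L[ℂ] H) := NormedSpace.exp '' E

/-- The orthogonal complement of `E` inside `S₂(H)` for the Hilbert–Schmidt
inner product. -/
def hsPerp (e : HilbertBasis ι ℂ H) (E : Set (H →L[ℂ] H)) : Set (H →L[ℂ] H) :=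
  {Y | MemS2 e Y ∧ ∀ X ∈ E, hsInner e X Y = 0}

/-- `E` is closed in `S₂(H)` with respect to the Hilbert–Schmidt norm. -/
def IsHSClosed (e : HilbertBasis ι ℂ H) (E : Set (H →L[ℂ] H)) : Prop :=
  ∀ X : H →L[ℂ] H, MemS2 e X → (∀ ε > (0:ℝ), ∃ Y ∈ E, hsNorm e (X - Y) < ε) → X ∈ E

open Filter Topology

section EMI

set_option linter.unusedSectionVars false

theorem hs_parseval (e : HilbertBasis ι ℂ H) (x : H) :
    HasSum (fun j => ‖(inner ℂ (e j) x : ℂ)‖ ^ 2) (‖x‖ ^ 2) := by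
  have h := lp.hasSum_norm (p := 2) (by norm_num) (e.repr x)
  simpa [HilbertBasis.repr_apply_apply] using h

theorem hs_adj_ennreal (e : HilbertBasis ι ℂ H) (A : H →L[ℂ] H) :
    ∑' i, ENNReal.ofReal (‖A (e i)‖ ^ 2) = ∑' i, ENNReal.ofReal (‖(star A) (e i)‖ ^ 2) := by
  have key : ∀ (B : H →L[ℂ] H) i, ENNReal.ofReal (‖B (e i)‖ ^ 2)
      = ∑' j, ENNReal.ofReal (‖(inner ℂ (e j) (B (e i)) : ℂ)‖ ^ 2) := by
    intro B i
    rw [← (hs_parseval e (B (e i))).tsum_eq, ENNReal.ofReal_tsum_of_nonneg]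
    · intro j; positivity
    · exact (hs_parseval e _).summable
  simp_rw [key]
  rw [ENNReal.tsum_comm]
  refine tsum_congr fun j => tsum_congr fun i => ?_
  rw [ContinuousLinearMap.star_eq_adjoint, ContinuousLinearMap.adjoint_inner_right,
    ← inner_conj_symm, RCLike.norm_conj]

theorem isHS_iff (e : HilbertBasis ι ℂ H) (A : H →L[ℂ] H) :
    IsHS e A ↔ ∑' i, ENNReal.ofReal (‖A (e i)‖ ^ 2) ≠ ⊤ := by
  constructor
  · intro h
    rw [← ENNReal.ofReal_tsum_of_nonneg (fun i => by positivity) h]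
    exact ENNReal.ofReal_ne_top
  · intro h
    have := ENNReal.summable_toReal h
    refine this.congr fun i => ?_
    rw [ENNReal.toReal_ofReal (by positivity)]

theorem IsHS.star {e : HilbertBasis ι ℂ H} {A : H →L[ℂ] H} (h : IsHS e A) : IsHS e (star A) := by
  rw [isHS_iff] at h ⊢
  rwa [← hs_adj_ennreal]

theorem hsNorm_star {e : HilbertBasis ι ℂ H} {A : H →L[ℂ] H} (h : IsHS e A) :
    hsNorm e (star A) = hsNorm e A := by
  have := hs_adj_ennreal e A
  rw [← ENNReal.ofReal_tsum_of_nonneg (fun i => by positivity) h,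
    ← ENNReal.ofReal_tsum_of_nonneg (fun i => by positivity) h.star,
    ENNReal.ofReal_eq_ofReal_iff (tsum_nonneg fun i => by positivity)
      (tsum_nonneg fun i => by positivity)] at this
  rw [hsNorm, hsNorm, this]

theorem IsHS.of_le {e : HilbertBasis ι ℂ H} {A B : H →L[ℂ] H} (h : IsHS e A) (C : ℝ)
    (hC : ∀ x, ‖B x‖ ≤ C * ‖A x‖) : IsHS e B := by
  refine Summable.of_nonneg_of_le (fun i => by positivity) (fun i => ?_) (h.mul_left (C ^ 2))
  rw [← mul_pow]
  exact pow_le_pow_left₀ (norm_nonneg _) (hC _) 2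

theorem hsNorm_le_of_le {e : HilbertBasis ι ℂ H} {A B : H →L[ℂ] H} (h : IsHS e A) (C : ℝ)
    (hC0 : 0 ≤ C)
    (hC : ∀ x, ‖B x‖ ≤ C * ‖A x‖) : hsNorm e B ≤ C * hsNorm e A := by
  unfold hsNorm
  rw [← Real.sqrt_sq hC0, ← Real.sqrt_mul (by positivity), ← tsum_mul_left]
  refine Real.sqrt_le_sqrt ?_
  refine Summable.tsum_le_tsum (fun i => ?_) (h.of_le C hC) (h.mul_left (C ^ 2))
  rw [← mul_pow]
  exact pow_le_pow_left₀ (norm_nonneg _) (hC _) 2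

theorem IsHS.mul_left {e : HilbertBasis ι ℂ H} {A : H →L[ℂ] H} (h : IsHS e A) (B : H →L[ℂ] H) :
    IsHS e (B * A) := h.of_le ‖B‖ fun x => B.le_opNorm (A x)

theorem IsHS.mul_right {e : HilbertBasis ι ℂ H} {A : H →L[ℂ] H} (h : IsHS e A) (B : H →L[ℂ] H) :
    IsHS e (A * B) := by
  have := (h.star.mul_left (Star.star B)).star
  rwa [star_mul, star_star, star_star] at this

theorem isHS_iff_mem (e : HilbertBasis ι ℂ H) (A : H →L[ℂ] H) :
    IsHS e A ↔ Memℓp (fun i => A (e i)) 2 := by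
  rw [memℓp_gen_iff (by norm_num)]
  simp [IsHS]

theorem IsHS.add {e : HilbertBasis ι ℂ H} {A B : H →L[ℂ] H} (hA : IsHS e A) (hB : IsHS e B) :
    IsHS e (A + B) := by
  rw [isHS_iff_mem] at *
  exact hA.add hB

theorem IsHS.sub {e : HilbertBasis ι ℂ H} {A B : H →L[ℂ] H} (hA : IsHS e A) (hB : IsHS e B) :
    IsHS e (A - B) := by
  rw [isHS_iff_mem] at *
  exact hA.sub hB

theorem IsHS.smul {e : HilbertBasis ι ℂ H} {A : H →L[ℂ] H} (hA : IsHS e A) (c : ℝ) :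
    IsHS e (c • A) := hA.of_le |c| fun x => by simp [norm_smul]

/-- The vector of `ℓ²(ι, H)` attached to a Hilbert–Schmidt operator. -/
def hsVec (e : HilbertBasis ι ℂ H) (A : H →L[ℂ] H) (h : IsHS e A) : lp (fun _ : ι => H) 2 :=
  ⟨fun i => A (e i), (isHS_iff_mem e A).1 h⟩

theorem norm_hsVec (e : HilbertBasis ι ℂ H) (A : H →L[ℂ] H) (h : IsHS e A) :
    hsNorm e A = ‖hsVec e A h‖ := by
  have := lp.norm_rpow_eq_tsum (p := 2) (by norm_num) (hsVec e A h)
  simp only [ENNReal.toReal_ofNat, Real.rpow_ofNat] at this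
  rw [hsNorm, Real.sqrt_eq_iff_eq_sq (tsum_nonneg fun i => by positivity) (norm_nonneg _), this]
  rfl

theorem hsNorm_add_le {e : HilbertBasis ι ℂ H} {A B : H →L[ℂ] H} (hA : IsHS e A) (hB : IsHS e B) :
    hsNorm e (A + B) ≤ hsNorm e A + hsNorm e B := by
  rw [norm_hsVec e A hA, norm_hsVec e B hB, norm_hsVec e _ (hA.add hB)]
  exact norm_add_le (hsVec e A hA) (hsVec e B hB)

theorem hsNorm_nonneg (e : HilbertBasis ι ℂ H) (A : H →L[ℂ] H) : 0 ≤ hsNorm e A :=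
  Real.sqrt_nonneg _

/-- real Hilbert–Schmidt inner product -/
def hsR {e : HilbertBasis ι ℂ H} {A B : H →L[ℂ] H} (hA : IsHS e A) (hB : IsHS e B) : ℝ :=
  (inner ℂ (hsVec e A hA) (hsVec e B hB) : ℂ).re

theorem hsNorm_add_sq {e : HilbertBasis ι ℂ H} {A B : H →L[ℂ] H} (hA : IsHS e A) (hB : IsHS e B) :
    hsNorm e (A + B) ^ 2 = hsNorm e A ^ 2 + 2 * hsR hA hB + hsNorm e B ^ 2 := by
  rw [norm_hsVec e A hA, norm_hsVec e B hB, norm_hsVec e _ (hA.add hB)]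
  exact norm_add_sq (𝕜 := ℂ) (hsVec e A hA) (hsVec e B hB)

theorem hsNorm_sub_sq {e : HilbertBasis ι ℂ H} {A B : H →L[ℂ] H} (hA : IsHS e A) (hB : IsHS e B) :
    hsNorm e (A - B) ^ 2 = hsNorm e A ^ 2 - 2 * hsR hA hB + hsNorm e B ^ 2 := by
  rw [norm_hsVec e A hA, norm_hsVec e B hB, norm_hsVec e _ (hA.sub hB)]
  exact norm_sub_sq (𝕜 := ℂ) (hsVec e A hA) (hsVec e B hB)

theorem hsR_self {e : HilbertBasis ι ℂ H} {A : H →L[ℂ] H} (hA : IsHS e A) :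
    hsR hA hA = hsNorm e A ^ 2 := by
  rw [norm_hsVec e A hA]
  exact (norm_sq_eq_re_inner (𝕜 := ℂ) (hsVec e A hA)).symm

theorem hsR_add_right {e : HilbertBasis ι ℂ H} {A B C : H →L[ℂ] H} (hA : IsHS e A)
    (hB : IsHS e B) (hC : IsHS e C) : hsR hA (hB.add hC) = hsR hA hB + hsR hA hC := by
  have : hsVec e _ (hB.add hC) = hsVec e B hB + hsVec e C hC := rfl
  rw [hsR, this, inner_add_right, Complex.add_re]; rfl

theorem hsR_star {e : HilbertBasis ι ℂ H} {A B : H →L[ℂ] H} (hA : IsHS e A) (hB : IsHS e B) :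
    hsR hA.star hB.star = hsR hA hB := by
  have h1 := hsNorm_add_sq hA hB
  have h2 := hsNorm_add_sq hA.star hB.star
  rw [← star_add, hsNorm_star (hA.add hB), hsNorm_star hA, hsNorm_star hB] at h2
  linarith

theorem hsR_mul_left {e : HilbertBasis ι ℂ H} {A B : H →L[ℂ] H} (hA : IsHS e A) (hB : IsHS e B)
    (C : H →L[ℂ] H) : hsR hA (hB.mul_left C) = hsR (hA.mul_left (star C)) hB := by
  unfold hsR
  rw [lp.inner_eq_tsum, lp.inner_eq_tsum]
  congr 1
  refine tsum_congr fun i => ?_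
  change (inner ℂ (A (e i)) (C (B (e i))) : ℂ) = inner ℂ ((star C) (A (e i))) (B (e i))
  rw [ContinuousLinearMap.star_eq_adjoint, ContinuousLinearMap.adjoint_inner_left]

theorem hsR_congr {e : HilbertBasis ι ℂ H} {A B A' B' : H →L[ℂ] H} (hA : IsHS e A) (hB : IsHS e B)
    (h1 : A = A') (h2 : B = B') : hsR hA hB = hsR (h1 ▸ hA : IsHS e A') (h2 ▸ hB : IsHS e B') := by
  subst h1 h2; rfl

theorem hsR_mul_right {e : HilbertBasis ι ℂ H} {A B : H →L[ℂ] H} (hA : IsHS e A) (hB : IsHS e B)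
    (C : H →L[ℂ] H) : hsR hA (hB.mul_right C) = hsR (hA.mul_right (star C)) hB := by
  rw [← hsR_star hA, ← hsR_star _ hB]
  rw [hsR_congr hA.star _ rfl (star_mul B C), hsR_mul_left hA.star hB.star,
    hsR_congr _ hB.star (show star (star C) * star A = star (A * star C) by simp) rfl]

/-- key convexity step -/
theorem hs_step {e : HilbertBasis ι ℂ H} {Z : H →L[ℂ] H} (hZ : IsHS e Z)
    {a a' b b' : H →L[ℂ] H} (ha : IsSelfAdjoint a) (ha' : IsSelfAdjoint a')
    (hb : IsSelfAdjoint b) (hb' : IsSelfAdjoint b')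
    (haa : a * a' = 1) (hbb : b' * b = 1) :
    2 * hsNorm e Z ≤ hsNorm e (a * a * Z * (b * b) + a' * a' * Z * (b' * b')) := by
  have hP : IsHS e (a * Z * b) := (hZ.mul_left a).mul_right b
  have hP' : IsHS e (a' * Z * b') := (hZ.mul_left a').mul_right b'
  have hQ : IsHS e (a * (a * Z * b) * b) := (hP.mul_left a).mul_right b
  have hQ' : IsHS e (a' * (a' * Z * b') * b') := (hP'.mul_left a').mul_right b'
  have gen : ∀ (c d R : H →L[ℂ] H) (hR : IsHS e R) (_ : IsSelfAdjoint c) (_ : IsSelfAdjoint d),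
      hsR hZ ((hR.mul_left c).mul_right d) = hsR ((hZ.mul_left c).mul_right d) hR := by
    intro c d R hR hc hd
    rw [hsR_mul_right hZ (hR.mul_left c), hsR_mul_left _ hR]
    refine hsR_congr _ _ ?_ rfl
    rw [hc.star_eq, hd.star_eq, mul_assoc]
  have e1 : hsR hZ hQ = hsNorm e (a * Z * b) ^ 2 := by
    rw [← hsR_self hP]; exact gen a b _ hP ha hb
  have e2 : hsR hZ hQ' = hsNorm e (a' * Z * b') ^ 2 := by
    rw [← hsR_self hP']; exact gen a' b' _ hP' ha' hb'
  have e3 : hsR hP hP' = hsNorm e Z ^ 2 := by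
    rw [← hsR_self hZ, ← gen a b _ hP' ha hb]
    refine hsR_congr _ _ rfl ?_
    calc a * (a' * Z * b') * b = (a * a') * Z * (b' * b) := by simp only [mul_assoc]
      _ = Z := by rw [haa, hbb]; simp
  have e4 := hsNorm_sub_sq hP hP'
  have hF := hQ.add hQ'
  have e5 : hsR hZ hF = hsR hZ hQ + hsR hZ hQ' := hsR_add_right _ _ _
  have h2Z : IsHS e (Z + Z) := hZ.add hZ
  have e6 : hsNorm e (a * (a * Z * b) * b + a' * (a' * Z * b') * b' - (Z + Z)) ^ 2 =
    hsNorm e (a * (a * Z * b) * b + a' * (a' * Z * b') * b') ^ 2 - 2 * hsR hF h2Z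
      + hsNorm e (Z + Z) ^ 2 := hsNorm_sub_sq hF h2Z
  have e7 : hsR hF h2Z = hsR hF hZ + hsR hF hZ := hsR_add_right _ _ _
  have e8 : hsR hF hZ = hsR hZ hF := by
    unfold hsR; exact inner_re_symm (𝕜 := ℂ) _ _
  have e9 := hsNorm_add_sq hZ hZ
  rw [hsR_self] at e9
  have e10 : a * a * Z * (b * b) + a' * a' * Z * (b' * b') =
      a * (a * Z * b) * b + a' * (a' * Z * b') * b' := by simp only [mul_assoc]
  rw [e10]
  refine le_of_sq_le_sq ?_ (hsNorm_nonneg _ _)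
  nlinarith [sq_nonneg (hsNorm e (a * Z * b - a' * Z * b')),
    sq_nonneg (hsNorm e (a * (a * Z * b) * b + a' * (a' * Z * b') * b' - (Z + Z)))]

theorem cfc_dom {a : H →L[ℂ] H} {f g : ℝ → ℝ}
    (hf : ContinuousOn f (spectrum ℝ a)) (hg : ContinuousOn g (spectrum ℝ a))
    (h : ∀ t ∈ spectrum ℝ a, |f t| ≤ |g t|) (x : H) : ‖cfc f a x‖ ≤ ‖cfc g a x‖ := by
  have key : ∀ k : ℝ → ℝ, ContinuousOn k (spectrum ℝ a) →
      ‖cfc k a x‖ ^ 2 = (inner ℂ (cfc (fun t => k t * k t) a x) x : ℂ).re := by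
    intro k hk
    rw [cfc_mul k k a hk hk]
    have hs : IsSelfAdjoint (cfc k a) := cfc_predicate k a
    have : (inner ℂ ((cfc k a * cfc k a) x) x : ℂ) = inner ℂ (cfc k a x) (cfc k a x) := by
      change (inner ℂ (cfc k a (cfc k a x)) x : ℂ) = _
      rw [← ContinuousLinearMap.adjoint_inner_right, ← ContinuousLinearMap.star_eq_adjoint,
        hs.star_eq]
    rw [this]
    exact norm_sq_eq_re_inner (𝕜 := ℂ) _
  have hle : cfc (fun t => f t * f t) a ≤ cfc (fun t => g t * g t) a := by
    refine cfc_mono (fun t ht => ?_) (hf.mul hf) (hg.mul hg)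
    have := h t ht
    nlinarith [abs_nonneg (f t), abs_mul_abs_self (f t), abs_mul_abs_self (g t)]
  rw [ContinuousLinearMap.le_def] at hle
  have h2 := hle.re_inner_nonneg_left x
  rw [sub_apply, inner_sub_left, map_sub] at h2
  have h3 := key f hf
  have h4 := key g hg
  refine le_of_sq_le_sq ?_ (norm_nonneg _)
  rw [h3, h4]
  exact sub_nonneg.1 h2

theorem exp_smul_add (X : H →L[ℂ] H) (s t : ℝ) :
    NormedSpace.exp ((s + t) • X) = NormedSpace.exp (s • X) * NormedSpace.exp (t • X) := by
  let _ : NormedAlgebra ℚ (H →L[ℂ] H) := NormedAlgebra.restrictScalars ℚ ℝ _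
  rw [add_smul]
  exact NormedSpace.exp_add_of_commute (((Commute.refl X).smul_left s).smul_right t)

theorem exp_smul_neg_mul (X : H →L[ℂ] H) (s : ℝ) :
    NormedSpace.exp ((-s) • X) * NormedSpace.exp (s • X) = 1 := by
  rw [← exp_smul_add]; simp

theorem exp_smul_mul_neg (X : H →L[ℂ] H) (s : ℝ) :
    NormedSpace.exp (s • X) * NormedSpace.exp ((-s) • X) = 1 := by
  rw [← exp_smul_add]; simp

theorem sa_smul {X : H →L[ℂ] H} (hX : IsSelfAdjoint X) (s : ℝ) : IsSelfAdjoint (s • X) :=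
  IsSelfAdjoint.smul (IsSelfAdjoint.all s) hX

theorem sa_exp {X : H →L[ℂ] H} (hX : IsSelfAdjoint X) (s : ℝ) :
    IsSelfAdjoint (NormedSpace.exp (s • X)) := by
  rw [← CFC.real_exp_eq_normedSpace_exp (sa_smul hX s)]
  exact cfc_predicate _ _

theorem exp_smul_eq_cfc {X : H →L[ℂ] H} (hX : IsSelfAdjoint X) (s : ℝ) :
    NormedSpace.exp (s • X) = cfc (fun t : ℝ => Real.exp (s * t)) X := by
  rw [← CFC.real_exp_eq_normedSpace_exp (sa_smul hX s)]
  have := cfc_comp_smul s Real.exp X (by fun_prop) hX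
  rw [← this]; simp

theorem spec_bound {X : H →L[ℂ] H} {t : ℝ} (ht : t ∈ spectrum ℝ X) :
    |t| ≤ ‖X‖ * ‖(1 : H →L[ℂ] H)‖ := spectrum.norm_le_norm_mul_of_mem ht

theorem exp_sub_one_eq_cfc {X : H →L[ℂ] H} (hX : IsSelfAdjoint X) :
    NormedSpace.exp X - 1 = cfc (fun t : ℝ => Real.exp t - 1) X := by
  rw [cfc_sub (R := ℝ) (fun t => Real.exp t) (fun _ => 1) X (by fun_prop) (by fun_prop),
    CFC.real_exp_eq_normedSpace_exp hX, cfc_const_one ℝ X]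

theorem IsHS.exp_sub_one {e : HilbertBasis ι ℂ H} {X : H →L[ℂ] H} (hX : IsSelfAdjoint X)
    (h : IsHS e X) : IsHS e (NormedSpace.exp X - 1) := by
  set M := ‖X‖ * ‖(1 : H →L[ℂ] H)‖
  have h' := h.smul (Real.exp M)
  refine h'.of_le 1 fun x => ?_
  rw [exp_sub_one_eq_cfc hX, one_mul]
  have : Real.exp M • X = cfc (fun t : ℝ => Real.exp M * t) X := by
    rw [cfc_const_mul_id (R := ℝ) (Real.exp M) X hX]
  rw [this]
  refine cfc_dom (by fun_prop) (by fun_prop) (fun t ht => ?_) x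
  have hb := spec_bound ht
  change |t| ≤ M at hb
  have hM : 0 ≤ M := (abs_nonneg t).trans hb
  have h1 : 1 ≤ Real.exp M := Real.one_le_exp hM
  rcases le_total 0 t with h0 | h0
  · have e1 := Real.add_one_le_exp (-t)
    have e2 : Real.exp t * Real.exp (-t) = 1 := by rw [← Real.exp_add]; simp
    have e3 : Real.exp t ≤ Real.exp M := Real.exp_le_exp.2 ((le_abs_self t).trans hb)
    have e4 : 1 ≤ Real.exp t := Real.one_le_exp h0
    rw [abs_of_nonneg (by linarith), abs_of_nonneg (by positivity)]
    nlinarith [Real.exp_pos t]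
  · have e1 := Real.add_one_le_exp t
    have e4 : Real.exp t ≤ 1 := Real.exp_le_one_iff.2 h0
    rw [abs_of_nonpos (by linarith), abs_of_nonpos (by nlinarith)]
    nlinarith

theorem IsHS.of_exp_sub_one {e : HilbertBasis ι ℂ H} {X : H →L[ℂ] H} (hX : IsSelfAdjoint X)
    (h : IsHS e (NormedSpace.exp X - 1)) : IsHS e X := by
  set M := ‖X‖ * ‖(1 : H →L[ℂ] H)‖
  have h' := h.smul (Real.exp M)
  refine h'.of_le 1 fun x => ?_
  rw [exp_sub_one_eq_cfc hX, one_mul]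
  have : Real.exp M • cfc (fun t : ℝ => Real.exp t - 1) X
      = cfc (fun t : ℝ => Real.exp M * (Real.exp t - 1)) X := by
    rw [cfc_const_mul (R := ℝ) (Real.exp M) _ X (by fun_prop)]
  rw [this]
  conv_lhs => rw [← cfc_id' ℝ X hX]
  refine cfc_dom (by fun_prop) (by fun_prop) (fun t ht => ?_) x
  have hb := spec_bound ht
  change |t| ≤ M at hb
  have hM : 0 ≤ M := (abs_nonneg t).trans hb
  have h1 : 1 ≤ Real.exp M := Real.one_le_exp hM
  rw [abs_mul, abs_of_pos (Real.exp_pos M)]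
  rcases le_total 0 t with h0 | h0
  · have e1 := Real.add_one_le_exp t
    rw [abs_of_nonneg h0, abs_of_nonneg (by linarith)]
    nlinarith
  · have e1 := Real.add_one_le_exp (-t)
    have e2 : Real.exp t * Real.exp (-t) = 1 := by rw [← Real.exp_add]; simp
    have e3 : Real.exp (-t) ≤ Real.exp M := Real.exp_le_exp.2 ((neg_le_abs t).trans hb)
    have e4 : Real.exp t ≤ 1 := Real.exp_le_one_iff.2 h0
    rw [abs_of_nonpos h0, abs_of_nonpos (by linarith)]
    nlinarith [Real.exp_pos t]

theorem hsNorm_smul {e : HilbertBasis ι ℂ H} {A : H →L[ℂ] H} (h : IsHS e A) {c : ℝ} (hc : 0 ≤ c) :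
    hsNorm e (c • A) ≤ c * hsNorm e A :=
  hsNorm_le_of_le h c hc fun x => by simp [norm_smul, abs_of_nonneg hc]

theorem hsNorm_le_of_tendsto {e : HilbertBasis ι ℂ H} {A : ℕ → H →L[ℂ] H} {B : H →L[ℂ] H}
    (hA : ∀ n, IsHS e (A n)) (hB : IsHS e B) (hl : Tendsto A atTop (𝓝 B)) {C : ℝ}
    (hC : ∀ n, hsNorm e (A n) ≤ C) : hsNorm e B ≤ C := by
  have hC0 : 0 ≤ C := (hsNorm_nonneg e _).trans (hC 0)
  refine Real.sqrt_le_iff.2 ⟨hC0, Summable.tsum_le_of_sum_le hB fun s => ?_⟩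
  have ht : Tendsto (fun n => ∑ i ∈ s, ‖A n (e i)‖ ^ 2) atTop (𝓝 (∑ i ∈ s, ‖B (e i)‖ ^ 2)) := by
    refine tendsto_finsetSum _ fun i _ => ?_
    refine (Tendsto.norm ?_).pow 2
    exact ((ContinuousLinearMap.apply ℂ H (e i)).continuous.tendsto B).comp hl
  refine le_of_tendsto' ht fun n => ?_
  have h1 : ∑ i ∈ s, ‖A n (e i)‖ ^ 2 ≤ ∑' i, ‖A n (e i)‖ ^ 2 :=
    Summable.sum_le_tsum s (fun i _ => by positivity) (hA n)
  exact h1.trans (Real.sqrt_le_iff.1 (hC n)).2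

/-- `e^{tY} e^{-tX} - e^{-tY} e^{tX}` -/
def emiG (X Y : H →L[ℂ] H) (t : ℝ) : H →L[ℂ] H :=
  NormedSpace.exp (t • Y) * NormedSpace.exp ((-t) • X)
    - NormedSpace.exp ((-t) • Y) * NormedSpace.exp (t • X)

theorem isHS_emiG {e : HilbertBasis ι ℂ H} {X Y : H →L[ℂ] H} (hX : MemS2 e X) (hY : MemS2 e Y)
    (t : ℝ) : IsHS e (emiG X Y t) := by
  have key : ∀ s : ℝ, IsHS e (NormedSpace.exp (s • Y) * NormedSpace.exp ((-s) • X) - 1) := by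
    intro s
    have h1 := (IsHS.exp_sub_one (sa_smul hY.1 s) (hY.2.smul s)).mul_right
      (NormedSpace.exp ((-s) • X))
    have h2 := IsHS.exp_sub_one (sa_smul hX.1 (-s)) (hX.2.smul (-s))
    have h3 := h1.add h2
    convert h3 using 1
    rw [sub_mul, one_mul]; abel
  have := (key t).sub (key (-t))
  convert this using 1
  rw [neg_neg, emiG]; abel

theorem emiG_double {e : HilbertBasis ι ℂ H} {X Y : H →L[ℂ] H} (hX : MemS2 e X) (hY : MemS2 e Y)
    (t : ℝ) : 2 * hsNorm e (emiG X Y t) ≤ hsNorm e (emiG X Y (2 * t)) := by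
  have h := hs_step (isHS_emiG hX hY t) (sa_exp hY.1 (t / 2)) (sa_exp hY.1 (-(t / 2)))
    (sa_exp hX.1 (-(t / 2))) (sa_exp hX.1 (t / 2)) (exp_smul_mul_neg _ _) (exp_smul_mul_neg _ _)
  simp only [← exp_smul_add] at h
  have r1 : t / 2 + t / 2 = t := by ring
  have r2 : -(t / 2) + -(t / 2) = -t := by ring
  rw [r1, r2] at h
  convert h using 2
  unfold emiG
  have d : 2 * t = t + t := by ring
  have d' : -(2 * t) = -t + -t := by ring
  rw [d', d]
  simp only [exp_smul_add]
  have i1 := exp_smul_mul_neg Y t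
  have i2 := exp_smul_neg_mul Y t
  have i3 := exp_smul_mul_neg X t
  have i4 := exp_smul_neg_mul X t
  generalize NormedSpace.exp (t • Y) = a at *
  generalize NormedSpace.exp ((-t) • Y) = a' at *
  generalize NormedSpace.exp (t • X) = b' at *
  generalize NormedSpace.exp ((-t) • X) = b at *
  have j1 : a * (a' * b') * b = 1 := by
    rw [← mul_assoc, i1, one_mul, i3]
  have j2 : a' * (a * b) * b' = 1 := by
    rw [← mul_assoc, i2, one_mul, i4]
  simp only [mul_sub, sub_mul]
  rw [j1, j2]
  simp only [mul_assoc]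
  abel

theorem emi_core {e : HilbertBasis ι ℂ H} {X Y : H →L[ℂ] H} (hX : MemS2 e X) (hY : MemS2 e Y) :
    hsNorm e (Y - X) ≤ hsNorm e (emiG X Y (1 / 2)) := by
  have hit : ∀ n : ℕ, 2 ^ n * hsNorm e (emiG X Y ((1 / 2) ^ n * (1 / 2)))
      ≤ hsNorm e (emiG X Y (1 / 2)) := by
    intro n
    induction n with
    | zero => simp
    | succ n ih =>
      refine le_trans ?_ ih
      have := emiG_double hX hY ((1 / 2) ^ (n + 1) * (1 / 2))
      have r : 2 * ((1 / 2 : ℝ) ^ (n + 1) * (1 / 2)) = (1 / 2) ^ n * (1 / 2) := by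
        rw [pow_succ]; ring
      rw [r] at this
      calc (2 : ℝ) ^ (n + 1) * hsNorm e (emiG X Y ((1 / 2) ^ (n + 1) * (1 / 2)))
          = 2 ^ n * (2 * hsNorm e (emiG X Y ((1 / 2) ^ (n + 1) * (1 / 2)))) := by
            rw [pow_succ]; ring
        _ ≤ _ := by gcongr
  have hder : HasDerivAt (emiG X Y) (Y - X - (-Y + X)) 0 := by
    have a1 : ∀ Z : H →L[ℂ] H, HasDerivAt (fun t : ℝ => NormedSpace.exp (t • Z)) Z 0 := by
      intro Z
      have := hasDerivAt_exp_smul_const (𝕂 := ℝ) Z 0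
      simpa using this
    have a2 : ∀ Z : H →L[ℂ] H, HasDerivAt (fun t : ℝ => NormedSpace.exp ((-t) • Z)) (-Z) 0 := by
      intro Z
      have := a1 (-Z)
      simpa using this
    have := ((a1 Y).mul (a2 X)).sub ((a2 Y).mul (a1 X))
    refine HasDerivAt.congr_deriv (f := emiG X Y) this ?_
    simp
    abel
  have hseq : Tendsto (fun n : ℕ => (1 / 2 : ℝ) ^ n * (1 / 2)) atTop (𝓝[≠] 0) := by
    refine tendsto_nhdsWithin_iff.2 ⟨?_, Eventually.of_forall fun n => ?_⟩
    · have := (tendsto_pow_atTop_nhds_zero_of_lt_one (r := (1 / 2 : ℝ)) (by norm_num)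
        (by norm_num)).mul_const (1 / 2 : ℝ)
      simpa using this
    · simp
  have hlim := (hder.tendsto_slope.comp hseq).const_smul (1 / 2 : ℝ)
  have hlim2 : Tendsto (fun n : ℕ => (2 : ℝ) ^ n • emiG X Y ((1 / 2) ^ n * (1 / 2))) atTop
      (𝓝 (Y - X)) := by
    convert hlim using 1
    · funext n
      have h0 : emiG X Y 0 = 0 := by simp [emiG]
      simp only [Function.comp, slope, vsub_eq_sub, h0, sub_zero, smul_smul]
      congr 1
      rw [mul_inv, ← inv_pow]
      norm_num
      ring
    · congr 1
      have : Y - X - (-Y + X) = (2 : ℝ) • (Y - X) := by rw [two_smul]; abel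
      rw [this, smul_smul]; norm_num
  refine hsNorm_le_of_tendsto (fun n => (isHS_emiG hX hY _).smul _) (hY.2.sub hX.2) hlim2 fun n => ?_
  exact (hsNorm_smul (isHS_emiG hX hY _) (by positivity)).trans (hit n)

theorem emi_step {e : HilbertBasis ι ℂ H} {X Y W T T' : H →L[ℂ] H} (hX : MemS2 e X)
    (hY : MemS2 e Y) (hW : MemS2 e W) (hT : T * T' = 1) (h : ℝ)
    (hTX : NormedSpace.exp X = star T * T)
    (hTY : NormedSpace.exp Y = star T * NormedSpace.exp (h • W) * T) :
    hsNorm e (Y - X) ≤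
      hsNorm e (NormedSpace.exp ((h / 2) • W) - NormedSpace.exp ((-(h / 2)) • W)) := by
  refine (emi_core hX hY).trans ?_
  set S := NormedSpace.exp ((h / 2) • W) - NormedSpace.exp ((-(h / 2)) • W) with hS
  have hSsa : IsSelfAdjoint S := (sa_exp hW.1 _).sub (sa_exp hW.1 _)
  have hSS : S * S = NormedSpace.exp (h • W) + NormedSpace.exp ((-h) • W) - 1 - 1 := by
    have r1 : h = h / 2 + h / 2 := by ring
    have r2 : -h = -(h / 2) + -(h / 2) := by ring
    rw [r2]
    nth_rewrite 1 [r1]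
    rw [exp_smul_add, exp_smul_add, hS, sub_mul, mul_sub, mul_sub, exp_smul_mul_neg,
      exp_smul_neg_mul]
    abel
  have hSHS : IsHS e S := by
    have h1 := (IsHS.exp_sub_one (sa_smul hW.1 (h / 2)) (hW.2.smul _)).sub
      (IsHS.exp_sub_one (sa_smul hW.1 (-(h / 2))) (hW.2.smul _))
    convert h1 using 1
    rw [hS]; abel
  -- abbreviations
  have x1 : NormedSpace.exp X = NormedSpace.exp ((1 / 2 : ℝ) • X) * NormedSpace.exp ((1 / 2 : ℝ) • X) := by
    rw [← exp_smul_add]; norm_num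
  have y1 : NormedSpace.exp Y = NormedSpace.exp ((1 / 2 : ℝ) • Y) * NormedSpace.exp ((1 / 2 : ℝ) • Y) := by
    rw [← exp_smul_add]; norm_num
  rw [x1] at hTX
  rw [y1] at hTY
  have xi := exp_smul_mul_neg X (1 / 2)
  have xi' := exp_smul_neg_mul X (1 / 2)
  have yi := exp_smul_mul_neg Y (1 / 2)
  have yi' := exp_smul_neg_mul Y (1 / 2)
  have wi := exp_smul_mul_neg W h
  have xs := sa_exp hX.1 (1 / 2)
  have xs' := sa_exp hX.1 (-(1 / 2))
  have ys := sa_exp hY.1 (1 / 2)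
  have ys' := sa_exp hY.1 (-(1 / 2))
  unfold emiG
  generalize NormedSpace.exp ((1 / 2 : ℝ) • X) = p at *
  generalize NormedSpace.exp ((-(1 / 2) : ℝ) • X) = p' at *
  generalize NormedSpace.exp ((1 / 2 : ℝ) • Y) = q at *
  generalize NormedSpace.exp ((-(1 / 2) : ℝ) • Y) = q' at *
  generalize NormedSpace.exp (h • W) = w at *
  generalize NormedSpace.exp ((-h) • W) = w' at *
  set R := T * p' with hR
  have hsR' : star R = p' * star T := by rw [hR, star_mul, xs'.star_eq]
  have hRR : star R * R = 1 := by
    calc star R * R = p' * (star T * T) * p' := by rw [hsR', hR]; simp only [mul_assoc]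
      _ = (p' * p) * (p * p') := by rw [← hTX]; simp only [mul_assoc]
      _ = 1 := by rw [xi, xi', one_mul]
  have hRi : R * (p * T') = 1 := by
    calc R * (p * T') = T * (p' * p) * T' := by rw [hR]; simp only [mul_assoc]
      _ = 1 := by rw [xi', mul_one, hT]
  have hRR' : R * star R = 1 := by
    have : star R = p * T' := by
      calc star R = star R * (R * (p * T')) := by rw [hRi, mul_one]
        _ = p * T' := by rw [← mul_assoc, hRR, one_mul]
    rw [this, hRi]
  have f1 : p' * (q * q) * p' = star R * w * R := by
    rw [hTY, hsR', hR]; simp only [mul_assoc]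
  have f2 : p * (q' * q') * p = star R * w' * R := by
    have g1 : (p * (q' * q') * p) * (p' * (q * q) * p') = 1 := by
      calc (p * (q' * q') * p) * (p' * (q * q) * p')
          = p * (q' * (q' * ((p * p') * q) * q)) * p' := by simp only [mul_assoc]
        _ = p * (q' * ((q' * q) * q)) * p' := by rw [xi, one_mul]
        _ = 1 := by rw [yi', one_mul, yi', mul_one, xi]
    have g2 : (star R * w * R) * (star R * w' * R) = 1 := by
      calc (star R * w * R) * (star R * w' * R)
          = star R * (w * (R * star R) * w') * R := by simp only [mul_assoc]
        _ = 1 := by rw [hRR', mul_one, wi, mul_one, hRR]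
    calc p * (q' * q') * p
        = (p * (q' * q') * p) * ((star R * w * R) * (star R * w' * R)) := by rw [g2, mul_one]
      _ = ((p * (q' * q') * p) * (p' * (q * q) * p')) * (star R * w' * R) := by
          rw [f1]; simp only [mul_assoc]
      _ = _ := by rw [g1, one_mul]
  set B := q * p' - q' * p with hB
  have hBB : star B * B = star (S * R) * (S * R) := by
    have c1 : p' * (q * q') * p = 1 := by rw [yi, mul_one, xi']
    have c2 : p * (q' * q) * p' = 1 := by rw [yi', mul_one, xi]
    calc star B * B = p' * (q * q) * p' - p' * (q * q') * p - p * (q' * q) * p'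
          + p * (q' * q') * p := by
          rw [hB, star_sub, star_mul, star_mul, xs.star_eq, xs'.star_eq, ys.star_eq, ys'.star_eq]
          simp only [sub_mul, mul_sub, mul_assoc]; abel
      _ = star R * w * R + star R * w' * R - 1 - 1 := by rw [c1, c2, f1, f2]; abel
      _ = star R * (S * S) * R := by
          rw [hSS]; simp only [mul_sub, sub_mul, mul_add, add_mul, mul_one, hRR]
      _ = _ := by rw [star_mul S R, hSsa.star_eq]; simp only [mul_assoc]
  have hnorm : ∀ x, ‖B x‖ = ‖(S * R) x‖ := by
    intro x
    have n1 : ∀ A : H →L[ℂ] H, ‖A x‖ ^ 2 = (inner ℂ ((star A * A) x) x : ℂ).re := by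
      intro A
      have : (inner ℂ ((star A * A) x) x : ℂ) = inner ℂ (A x) (A x) := by
        change (inner ℂ ((star A) (A x)) x : ℂ) = _
        rw [ContinuousLinearMap.star_eq_adjoint, ContinuousLinearMap.adjoint_inner_left]
      rw [this]
      exact norm_sq_eq_re_inner (𝕜 := ℂ) _
    have := n1 B
    rw [hBB, ← n1 (S * R)] at this
    exact (sq_eq_sq₀ (norm_nonneg _) (norm_nonneg _)).1 this
  have hSR : IsHS e (S * R) := hSHS.mul_right R
  have s1 : hsNorm e B = hsNorm e (S * R) := by
    unfold hsNorm; simp only [hnorm]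
  rw [s1, ← hsNorm_star hSR, star_mul S R, hSsa.star_eq]
  have s2 := hsNorm_le_of_le (B := star R * S) hSHS 1 zero_le_one (fun x => by
    have hy : ∀ y : H, ‖(star R) y‖ = ‖y‖ := by
      intro y
      have : ‖(star R) y‖ ^ 2 = ‖y‖ ^ 2 := by
        rw [@norm_sq_eq_re_inner ℂ, @norm_sq_eq_re_inner ℂ _ _ _ _ y]
        rw [ContinuousLinearMap.star_eq_adjoint, ContinuousLinearMap.adjoint_inner_left,
          ← ContinuousLinearMap.star_eq_adjoint]
        have : R ((star R) y) = y := by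
          change (R * star R) y = y
          rw [hRR']; rfl
        rw [← inner_conj_symm, this]; simp
      exact (sq_eq_sq₀ (norm_nonneg _) (norm_nonneg _)).1 this
    rw [one_mul]
    exact (hy (S x)).le)
  rwa [one_mul] at s2

theorem abs_sinh_bound (x M : ℝ) (hx : |x| ≤ M) :
    |Real.exp x - Real.exp (-x)| ≤ 2 * |x| * Real.cosh M := by
  have key : ∀ y : ℝ, 0 ≤ y → Real.sinh y ≤ y * Real.cosh y := by
    intro y hy
    have hmono : MonotoneOn (fun y : ℝ => y * Real.cosh y - Real.sinh y) (Set.Ici 0) := by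
      refine monotoneOn_of_deriv_nonneg (convex_Ici 0) (by fun_prop) (by fun_prop) fun z hz => ?_
      rw [interior_Ici] at hz
      have : HasDerivAt (fun y : ℝ => y * Real.cosh y - Real.sinh y)
          (1 * Real.cosh z + z * Real.sinh z - Real.cosh z) z :=
        ((hasDerivAt_id z).mul (Real.hasDerivAt_cosh z)).sub (Real.hasDerivAt_sinh z)
      rw [this.deriv]
      have hz' : 0 < z := hz
      have := (Real.sinh_nonneg_iff).2 hz'.le
      nlinarith
    have := hmono (Set.mem_Ici.2 le_rfl) (Set.mem_Ici.2 hy) hy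
    simp at this
    linarith
  have h1 : Real.exp x - Real.exp (-x) = 2 * Real.sinh x := by rw [Real.sinh_eq]; ring
  rw [h1, abs_mul, abs_two, mul_assoc]
  refine mul_le_mul_of_nonneg_left ?_ (by norm_num)
  rw [Real.abs_sinh]
  refine (key _ (abs_nonneg x)).trans ?_
  refine mul_le_mul_of_nonneg_left ?_ (abs_nonneg x)
  rw [Real.cosh_le_cosh, abs_abs]
  exact hx.trans (le_abs_self M)

theorem emi_sinh {e : HilbertBasis ι ℂ H} {W : H →L[ℂ] H} (hW : MemS2 e W) {h : ℝ} (hh : 0 ≤ h) :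
    hsNorm e (NormedSpace.exp ((h / 2) • W) - NormedSpace.exp ((-(h / 2)) • W)) ≤
      h * Real.cosh (h / 2 * (‖W‖ * ‖(1 : H →L[ℂ] H)‖)) * hsNorm e W := by
  set M := ‖W‖ * ‖(1 : H →L[ℂ] H)‖ with hM
  have hc : 0 ≤ h * Real.cosh (h / 2 * M) := mul_nonneg hh (Real.cosh_pos _).le
  refine (hsNorm_le_of_le (hW.2.smul (h * Real.cosh (h / 2 * M))) 1 zero_le_one fun x => ?_).trans ?_
  · rw [exp_smul_eq_cfc hW.1, exp_smul_eq_cfc hW.1, one_mul,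
      ← cfc_sub (R := ℝ) _ _ W (by fun_prop) (by fun_prop),
      ← cfc_const_mul_id (R := ℝ) (h * Real.cosh (h / 2 * M)) W hW.1]
    refine cfc_dom (by fun_prop) (by fun_prop) (fun t ht => ?_) x
    have hb := spec_bound ht
    have hx : |h / 2 * t| ≤ h / 2 * M := by
      rw [abs_mul, abs_of_nonneg (by linarith)]
      exact mul_le_mul_of_nonneg_left hb (by linarith)
    have := abs_sinh_bound _ _ hx
    rw [abs_mul (h * Real.cosh (h / 2 * M)), abs_of_nonneg hc]
    rw [abs_mul, abs_of_nonneg (show 0 ≤ h / 2 by linarith)] at this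
    rw [neg_mul]
    refine this.trans (le_of_eq ?_)
    ring
  · rw [one_mul]; exact hsNorm_smul hW.2 hc

theorem emi_main {e : HilbertBasis ι ℂ H} {U V : H →L[ℂ] H}
    (hU : MemS2 e U) (hV : MemS2 e V) :
    hsNorm e (U - V) ≤ hsNorm e (plog
      (NormedSpace.exp (-((2:ℝ)⁻¹ • U)) * NormedSpace.exp V *
        NormedSpace.exp (-((2:ℝ)⁻¹ • U)))) := by
  rw [← neg_smul]
  set A := NormedSpace.exp ((2:ℝ)⁻¹ • U) with hA
  set A' := NormedSpace.exp ((-(2:ℝ)⁻¹) • U) with hA'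
  have hAs : IsSelfAdjoint A := sa_exp hU.1 _
  have hAs' : IsSelfAdjoint A' := sa_exp hU.1 _
  have hAA : A * A' = 1 := exp_smul_mul_neg _ _
  have hAA' : A' * A = 1 := exp_smul_neg_mul _ _
  have hAU : A * A = NormedSpace.exp U := by
    rw [hA, ← exp_smul_add]; norm_num
  have hAU' : A' * A' = NormedSpace.exp ((-1 : ℝ) • U) := by
    rw [hA', ← exp_smul_add]; norm_num
  -- generic: positivity
  have pos : ∀ T T' : H →L[ℂ] H, T * T' = 1 → T' * T = 1 → IsStrictlyPositive (star T * T) := by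
    intro T T' h1 h2
    have hu : IsUnit T := ⟨⟨T, T', h1, h2⟩, rfl⟩
    exact (hu.star.mul hu).isStrictlyPositive (star_mul_self_nonneg T)
  -- W
  set K := A' * NormedSpace.exp V * A' with hK
  have vh : NormedSpace.exp V
      = NormedSpace.exp ((1 / 2 : ℝ) • V) * NormedSpace.exp ((1 / 2 : ℝ) • V) := by
    rw [← exp_smul_add]; norm_num
  have hKpos : IsStrictlyPositive K := by
    have := pos (NormedSpace.exp ((1 / 2 : ℝ) • V) * A') (A * NormedSpace.exp ((-(1 / 2) : ℝ) • V))
      (by rw [mul_assoc, ← mul_assoc A', hAA', one_mul, exp_smul_mul_neg])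
      (by rw [mul_assoc, ← mul_assoc _ _ A', exp_smul_neg_mul, one_mul, hAA])
    convert this using 1
    rw [star_mul, hAs'.star_eq, (sa_exp hV.1 _).star_eq, hK, vh]
    simp only [mul_assoc]
  set W := plog K with hWdef
  have hWs : IsSelfAdjoint W := cfc_predicate _ _
  have hWe : NormedSpace.exp W = K := CFC.exp_log K hKpos
  have hWHS : IsHS e W := by
    refine IsHS.of_exp_sub_one hWs ?_
    rw [hWe]
    have h1 := ((IsHS.exp_sub_one hV.1 hV.2).mul_left A').mul_right A'
    have h2 := IsHS.exp_sub_one (sa_smul hU.1 (-1)) (hU.2.smul (-1))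
    convert h1.add h2 using 1
    rw [← hAU', hK, mul_sub, sub_mul, mul_one]; abel
  have hW : MemS2 e W := ⟨hWs, hWHS⟩
  -- curve
  let T : ℝ → H →L[ℂ] H := fun s => NormedSpace.exp ((s / 2) • W) * A
  let T' : ℝ → H →L[ℂ] H := fun s => A' * NormedSpace.exp ((-(s / 2)) • W)
  have hT : ∀ s, T s * T' s = 1 := fun s => by
    simp only [T, T']
    rw [mul_assoc, ← mul_assoc A, hAA, one_mul, exp_smul_mul_neg]
  have hT' : ∀ s, T' s * T s = 1 := fun s => by
    simp only [T, T']
    rw [mul_assoc, ← mul_assoc _ _ A, exp_smul_neg_mul, one_mul, hAA']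
  have hTT : ∀ s, star (T s) * T s = A * NormedSpace.exp (s • W) * A := fun s => by
    simp only [T]
    have r : s = s / 2 + s / 2 := by ring
    conv_rhs => rw [r, exp_smul_add]
    rw [star_mul, hAs.star_eq, (sa_exp hWs _).star_eq]
    simp only [mul_assoc]
  let X : ℝ → H →L[ℂ] H := fun s => CFC.log (star (T s) * T s)
  have hXe : ∀ s, NormedSpace.exp (X s) = star (T s) * T s := fun s =>
    CFC.exp_log _ (pos _ _ (hT s) (hT' s))
  have hX : ∀ s, MemS2 e (X s) := fun s => by
    have hs : IsSelfAdjoint (X s) := IsSelfAdjoint.log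
    refine ⟨hs, IsHS.of_exp_sub_one hs ?_⟩
    rw [hXe, hTT]
    have h1 := ((IsHS.exp_sub_one (sa_smul hWs s) (hWHS.smul s)).mul_left A).mul_right A
    have h2 := IsHS.exp_sub_one hU.1 hU.2
    convert h1.add h2 using 1
    rw [← hAU, mul_sub, sub_mul, mul_one]; abel
  have hX0 : X 0 = U := by
    simp only [X]
    rw [hTT, zero_smul, NormedSpace.exp_zero, mul_one, hAU]
    exact CFC.log_exp U hU.1
  have hX1 : X 1 = V := by
    simp only [X]
    rw [hTT, one_smul, hWe, hK]
    have : A * (A' * NormedSpace.exp V * A') * A = NormedSpace.exp V := by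
      calc A * (A' * NormedSpace.exp V * A') * A
          = (A * A') * NormedSpace.exp V * (A' * A) := by simp only [mul_assoc]
        _ = _ := by rw [hAA, hAA', one_mul, mul_one]
    rw [this]
    exact CFC.log_exp V hV.1
  set M := ‖W‖ * ‖(1 : H →L[ℂ] H)‖ with hM
  have hstep : ∀ s h : ℝ, 0 ≤ h → hsNorm e (X (s + h) - X s) ≤
      h * Real.cosh (h / 2 * M) * hsNorm e W := by
    intro s h hh
    refine le_trans ?_ (emi_sinh hW hh)
    refine emi_step (hX s) (hX (s + h)) hW (hT s) h (hXe s) ?_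
    rw [hXe, hTT]
    have r : s + h = s / 2 + (h + s / 2) := by ring
    simp only [T]
    rw [r, exp_smul_add, exp_smul_add, star_mul, hAs.star_eq, (sa_exp hWs _).star_eq]
    simp only [mul_assoc]
  have hind : ∀ (h : ℝ), 0 ≤ h → ∀ k : ℕ, hsNorm e (X (k * h) - X 0) ≤
      k * (h * Real.cosh (h / 2 * M) * hsNorm e W) := by
    intro h hh k
    induction k with
    | zero => simp [hsNorm]
    | succ k ih =>
      have e1 : X ((k + 1 : ℕ) * h) - X 0 = (X (k * h + h) - X (k * h)) + (X (k * h) - X 0) := by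
        have : ((k + 1 : ℕ) : ℝ) * h = k * h + h := by push_cast; ring
        rw [this]; abel
      rw [e1]
      refine (hsNorm_add_le ((hX _).2.sub (hX _).2) ((hX _).2.sub (hX _).2)).trans ?_
      have := hstep (k * h) h hh
      push_cast
      linarith
  have hfin : ∀ n : ℕ, hsNorm e (U - V) ≤
      Real.cosh ((1 / ((n : ℝ) + 1)) / 2 * M) * hsNorm e W := by
    intro n
    have hn : (0 : ℝ) < (n : ℝ) + 1 := by positivity
    have := hind (1 / ((n : ℝ) + 1)) (by positivity) (n + 1)
    have r : ((n + 1 : ℕ) : ℝ) * (1 / ((n : ℝ) + 1)) = 1 := by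
      push_cast; field_simp
    rw [r, hX1, hX0, mul_assoc (1 / ((n : ℝ) + 1)), ← mul_assoc, r, one_mul] at this
    have hsw : hsNorm e (U - V) = hsNorm e (V - U) := by
      unfold hsNorm
      simp only [sub_apply, norm_sub_rev]
    rwa [hsw]
  have hlim : Tendsto (fun n : ℕ => Real.cosh ((1 / ((n : ℝ) + 1)) / 2 * M) * hsNorm e W) atTop
      (𝓝 (Real.cosh (0 / 2 * M) * hsNorm e W)) := by
    refine Tendsto.mul_const _ ?_
    refine (Real.continuous_cosh.tendsto _).comp ?_
    exact (tendsto_one_div_add_atTop_nhds_zero_nat.div_const 2).mul_const M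
  have := ge_of_tendsto' hlim hfin
  simpa using this

theorem pinvsqrt_exp {U : H →L[ℂ] H} (hU : IsSelfAdjoint U) :
    pinvsqrt (NormedSpace.exp U) = NormedSpace.exp (-((2:ℝ)⁻¹ • U)) := by
  rw [← neg_smul, exp_smul_eq_cfc hU, pinvsqrt, ← CFC.real_exp_eq_normedSpace_exp hU]
  rw [← cfc_comp' (R := ℝ) (fun t : ℝ => (Real.sqrt t)⁻¹) Real.exp U ?_ (by fun_prop) hU]
  · congr 1
    funext t
    rw [← Real.exp_half, ← Real.exp_neg]
    congr 1; ring
  · refine ContinuousOn.inv₀ (by fun_prop) ?_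
    rintro _ ⟨t, _, rfl⟩
    exact (Real.sqrt_pos.2 (Real.exp_pos t)).ne'

end EMI

/-- **Al-Kashi inequality.** For `U, V ∈ S₂(H)`,
`d(exp U, exp V) ≥ ‖U − V‖₂`; explicitly
`‖log(exp(−U/2) exp(V) exp(−U/2))‖₂ ≥ ‖U − V‖₂`. -/
theorem statement7 (e : HilbertBasis ι ℂ H) (U V : H →L[ℂ] H)
    (hU : MemS2 e U) (hV : MemS2 e V) :
    hsNorm e (U - V) ≤ gdist e (NormedSpace.exp U) (NormedSpace.exp V) ∧
    hsNorm e (U - V) ≤ hsNorm e (plog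
      (NormedSpace.exp (-((2:ℝ)⁻¹ • U)) * NormedSpace.exp V *
        NormedSpace.exp (-((2:ℝ)⁻¹ • U)))) := by
  refine ⟨?_, emi_main hU hV⟩
  rw [gdist, pinvsqrt_exp hU.1]
  exact emi_main hU hV
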